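/- Let k be an algebraically closed field. Let A and B be commutative rings containing k (i.e. commutative k-algebras) with connected prime spectra, and assume A is reduced. Let 𝔪 ⊂ A be a maximal ideal with A/𝔪 = k. Then the group of units (A ⊗_k B)^× is the internal direct sum of its two subgroups A^×B^× = { (a ⊗ 1)(1 ⊗ b) : a ∈ A^×, b ∈ B^× } and 1 + 𝔪 ⊗ Nil(B) = { 1 + x : x in the image of 𝔪 ⊗_k Nil(B) in A ⊗_k B }. -/

import Mathlib

universe u

open TensorProduct

variable (k : Type u) [Field k]

/-- The subset `A^× B^× = {(a ⊗ 1)(1 ⊗ b) : a ∈ A^×, b ∈ B^×}` of `A ⊗_k B`. -/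
def unitsS1 (A B : Type u) [CommRing A] [Algebra k A] [CommRing B] [Algebra k B] :
    Set (A ⊗[k] B) :=
  { w | ∃ (a : Aˣ) (b : Bˣ), w = (a : A) ⊗ₜ[k] (b : B) }

/-- The subset `1 + 𝔪 ⊗ Nil(B)` of `A ⊗_k B`: elements `1 + x` with `x` in the
image of the natural map `𝔪 ⊗_k Nil(B) → A ⊗_k B`. -/
def unitsS2 (A B : Type u) [CommRing A] [Algebra k A] [CommRing B] [Algebra k B]
    (𝔪 : Ideal A) : Set (A ⊗[k] B) :=
  { w | ∃ x ∈ LinearMap.range (TensorProduct.map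
      (Submodule.restrictScalars k 𝔪).subtype
      (Submodule.restrictScalars k (nilradical B)).subtype), w = 1 + x }

/-- `(A ⊗_k B)ˣ` is the internal direct sum of the subgroups `A^× B^×` and
`1 + 𝔪 ⊗ Nil(B)`: every unit is a product of an element of each, in a unique way. -/
def IsUnitsDirectSum (A B : Type u) [CommRing A] [Algebra k A] [CommRing B]
    [Algebra k B] (𝔪 : Ideal A) : Prop :=
  (∀ u : (A ⊗[k] B)ˣ, ∃ s ∈ unitsS1 k A B, ∃ t ∈ unitsS2 k A B 𝔪,
      (u : A ⊗[k] B) = s * t) ∧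
  ∀ s ∈ unitsS1 k A B, ∀ s' ∈ unitsS1 k A B, ∀ t ∈ unitsS2 k A B 𝔪,
    ∀ t' ∈ unitsS2 k A B 𝔪, s * t = s' * t' → s = s' ∧ t = t'

theorem exists_algHom_apply_ne_zero {k B : Type*} [Field k] [IsAlgClosed k] [CommRing B]
    [Algebra k B] [Algebra.FiniteType k B] {b : B} (hb : ¬ IsNilpotent b) :
    ∃ y : B →ₐ[k] k, y b ≠ 0 := by
  have : IsJacobsonRing B := isJacobsonRing_of_finiteType (A := k)
  obtain ⟨M, hM, hbM⟩ : ∃ M : Ideal B, M.IsMaximal ∧ b ∉ M := by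
    by_contra! h
    refine hb (mem_nilradical.1 ?_)
    have h2 := (isJacobsonRing_iff.1 this) (nilradical B) (Ideal.radical_isRadical ⊥)
    rw [← h2, Ideal.jacobson, Ideal.mem_sInf]
    exact fun _ hI => h _ hI.2
  let := Ideal.Quotient.field M
  have := finite_of_finite_type_of_isJacobsonRing k (B ⧸ M)
  let e := AlgEquiv.ofBijective (Algebra.ofId k (B ⧸ M))
    IsAlgClosed.algebraMap_bijective_of_isIntegral
  refine ⟨e.symm.toAlgHom.comp (Ideal.Quotient.mkₐ k M), ?_⟩
  simpa [Ideal.Quotient.eq_zero_iff_mem] using hbM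

theorem exists_sub_algebraMap_mem_of_forall_algHom_eq {k B : Type*} [Field k] [IsAlgClosed k]
    [CommRing B] [Algebra k B] [Algebra.FiniteType k B] (q : Ideal B) [q.IsPrime] (b : B)
    (h : ∀ y y' : B ⧸ q →ₐ[k] k, y (Ideal.Quotient.mk q b) = y' (Ideal.Quotient.mk q b)) :
    ∃ c : k, b - algebraMap k B c ∈ q := by
  obtain ⟨y, -⟩ := exists_algHom_apply_ne_zero (k := k) (b := (1 : B ⧸ q)) (by simp)
  refine ⟨y (Ideal.Quotient.mk q b), ?_⟩
  by_contra hq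
  rw [← Ideal.Quotient.eq_zero_iff_mem] at hq
  obtain ⟨y', hy'⟩ := exists_algHom_apply_ne_zero (k := k) (mt IsNilpotent.eq_zero hq)
  refine hy' ?_
  rw [map_sub, map_sub, h y' y, ← Ideal.Quotient.algebraMap_eq, ← IsScalarTower.algebraMap_apply,
    AlgHom.commutes, sub_eq_zero]
  rfl

open Polynomial in
theorem exists_isNilpotent_sub_algebraMap {k R : Type*} [Field k] [CommRing R] [Algebra k R]
    [ConnectedSpace (PrimeSpectrum R)] (g : R)
    (h : ∀ p : Ideal R, p.IsPrime → ∃ c : k, g - algebraMap k R c ∈ p) :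
    ∃ c : k, IsNilpotent (g - algebraMap k R c) := by
  obtain ⟨P, hP0, hP⟩ : ∃ P : k[X], P ≠ 0 ∧ aeval g P = 0 := by
    by_contra! hg
    obtain ⟨p, hp, -, hdisj⟩ := Ideal.exists_le_prime_disjoint (⊥ : Ideal R)
      ((nonZeroDivisors k[X]).map (aeval (R := k) g)) (by
        rw [Set.disjoint_left]
        rintro _ h0 ⟨Q, hQ, rfl⟩
        exact hg Q (nonZeroDivisors.ne_zero hQ) h0)
    obtain ⟨c, hc⟩ := h p hp
    refine Set.disjoint_left.1 hdisj hc ⟨X - C c, ?_, by simp⟩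
    exact mem_nonZeroDivisors_of_ne_zero (X_sub_C_ne_zero c)
  obtain ⟨p₀⟩ := (inferInstance : Nonempty (PrimeSpectrum R))
  obtain ⟨c, hc⟩ := h p₀.asIdeal p₀.isPrime
  obtain ⟨Q, hPQ, hQ⟩ := exists_eq_pow_rootMultiplicity_mul_and_not_dvd P hP0 c
  have hQc : Q.eval c ≠ 0 := fun h0 => hQ (dvd_iff_isRoot.2 h0)
  have hdisj : ∀ p : PrimeSpectrum R, g - algebraMap k R c ∈ p.asIdeal →
      aeval g Q ∉ p.asIdeal := by
    intro p h1 h2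
    obtain ⟨Q', hQ'⟩ := X_sub_C_dvd_sub_C_eval (a := c) (p := Q)
    have h3 : aeval g Q - algebraMap k R (Q.eval c) = (g - algebraMap k R c) * aeval g Q' := by
      simpa using congrArg (aeval g) hQ'
    have h4 : algebraMap k R (Q.eval c) ∈ p.asIdeal := by
      rw [← sub_sub_cancel (aeval g Q) (algebraMap k R (Q.eval c)), h3]
      exact sub_mem h2 (Ideal.mul_mem_right _ _ h1)
    exact p.isPrime.ne_top
      (Ideal.eq_top_of_isUnit_mem _ h4 ((IsUnit.mk0 _ hQc).map (algebraMap k R)))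
  have hcover : ∀ p : PrimeSpectrum R, aeval g Q ∉ p.asIdeal →
      g - algebraMap k R c ∈ p.asIdeal := by
    intro p h2
    have h3 : (g - algebraMap k R c) ^ P.rootMultiplicity c * aeval g Q ∈ p.asIdeal := by
      have := congrArg (aeval g) hPQ
      simp only [hP, map_mul, map_pow, map_sub, aeval_X, aeval_C] at this
      rw [← this]
      exact zero_mem _
    exact p.isPrime.mem_of_pow_mem _ ((p.isPrime.mem_or_mem h3).resolve_right h2)
  have hV : PrimeSpectrum.zeroLocus {g - algebraMap k R c} =
      (PrimeSpectrum.zeroLocus {aeval g Q})ᶜ := by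
    ext p
    simpa using ⟨hdisj p, hcover p⟩
  have huniv : PrimeSpectrum.zeroLocus {g - algebraMap k R c} = Set.univ := by
    refine IsClopen.eq_univ ⟨PrimeSpectrum.isClosed_zeroLocus _, ?_⟩ ⟨p₀, by simpa using hc⟩
    rw [hV]
    exact (PrimeSpectrum.isClosed_zeroLocus _).isOpen_compl
  refine ⟨c, nilpotent_iff_mem_prime.2 fun J hJ => ?_⟩
  have : (⟨J, hJ⟩ : PrimeSpectrum R) ∈ PrimeSpectrum.zeroLocus {g - algebraMap k R c} := by
    rw [huniv]; trivial
  simpa using this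

/-- Specialization of the second tensor factor at a `k`-point. -/
def specializeRight {k : Type*} [Field k] (A : Type*) {B : Type*} [CommRing A] [Algebra k A]
    [CommRing B] [Algebra k B] (y : B →ₐ[k] k) : A ⊗[k] B →ₐ[k] A :=
  (Algebra.TensorProduct.rid k k A).toAlgHom.comp
    (Algebra.TensorProduct.map (AlgHom.id k A) y)

@[simp]
theorem specializeRight_tmul {k A B : Type*} [Field k] [CommRing A] [Algebra k A]
    [CommRing B] [Algebra k B] (y : B →ₐ[k] k) (a : A) (b : B) :
    specializeRight A y (a ⊗ₜ b) = y b • a := by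
  simp [specializeRight]

theorem specializeRight_map {k A B A' B' : Type*} [Field k] [CommRing A] [Algebra k A]
    [CommRing B] [Algebra k B] [CommRing A'] [Algebra k A'] [CommRing B'] [Algebra k B']
    (f : A →ₐ[k] A') (g : B →ₐ[k] B') (y : B' →ₐ[k] k) (w : A ⊗[k] B) :
    specializeRight A' y (Algebra.TensorProduct.map f g w) =
      f (specializeRight A (y.comp g) w) := by
  have : (specializeRight A' y).comp (Algebra.TensorProduct.map f g) =
      f.comp (specializeRight A (y.comp g)) := by
    ext <;> simp
  exact DFunLike.congr_fun this w

theorem exists_valuation_specializeRight_bound {k F B Γ : Type*} [Field k] [Field F] [Algebra k F]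
    [CommRing B] [Algebra k B] [LinearOrderedCommGroupWithZero Γ] (v : Valuation F Γ)
    (hv : ∀ c : k, v (algebraMap k F c) ≤ 1) {u : F ⊗[k] B} (hu : u ≠ 0) :
    ∃ (γ : Γ) (β : B), β ≠ 0 ∧ ∀ y : B →ₐ[k] k, v (specializeRight F y u) ≤ γ ∧
      (y β ≠ 0 → v (specializeRight F y u) = γ) := by
  obtain ⟨a, rfl⟩ := TensorProduct.eq_repr_basis_right (Module.Basis.ofVectorSpace k B) u
  set 𝒞 := Module.Basis.ofVectorSpace k B
  have hne : a.support.Nonempty := by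
    by_contra h
    simp only [Finset.not_nonempty_iff_eq_empty, Finsupp.support_eq_empty] at h
    simp [h] at hu
  obtain ⟨s, hs, hmax⟩ := Finset.exists_max_image a.support (fun i => v (a i)) hne
  have has : a s ≠ 0 := Finsupp.mem_support_iff.1 hs
  have hle : ∀ i, v (a i / a s) ≤ 1 := fun i => by
    rw [map_div₀]
    refine div_le_one_of_le₀ ?_ zero_le
    by_cases hi : i ∈ a.support
    · exact hmax i hi
    · simp [Finsupp.notMem_support_iff.1 hi]
  let 𝔫 : Submodule k F :=
    { carrier := {x | v x < 1}
      zero_mem' := by simp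
      add_mem' := fun hx hy => v.map_add_lt hx hy
      smul_mem' := fun c x hx => by
        simp only [Set.mem_ofPred_eq] at hx ⊢
        rw [Algebra.smul_def, map_mul]
        exact (mul_le_of_le_one_left' (hv c)).trans_lt hx }
  obtain ⟨φ, hφ1, hφ⟩ := Submodule.exists_le_ker_of_notMem (p := 𝔫) (v := (1 : F))
    (by simp [𝔫])
  have key : ∀ y : B →ₐ[k] k, specializeRight F y (a.sum fun i m => m ⊗ₜ 𝒞 i) =
      a s * ∑ i ∈ a.support, y (𝒞 i) • (a i / a s) := fun y => by
    simp only [Finsupp.sum, map_sum, specializeRight_tmul, Finset.mul_sum, mul_smul_comm,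
      mul_div_cancel₀ _ has]
  have hsum : ∀ y : B →ₐ[k] k, v (∑ i ∈ a.support, y (𝒞 i) • (a i / a s)) ≤ 1 := fun y => by
    refine v.map_sum_le fun i _ => ?_
    rw [Algebra.smul_def, map_mul]
    exact mul_le_one' (hv _) (hle i)
  refine ⟨v (a s), ∑ i ∈ a.support, φ (a i / a s) • 𝒞 i, fun h0 => ?_, fun y => ⟨?_, fun hy => ?_⟩⟩
  · have := linearIndependent_iff'.1 𝒞.linearIndependent _ _ h0 s hs
    rw [div_self has] at this
    exact hφ1 this
  · rw [key, map_mul]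
    exact mul_le_of_le_one_right' (hsum y)
  · rw [key, map_mul]
    refine mul_right_eq_self₀.2 (Or.inl ((hsum y).antisymm (not_lt.1 fun hlt => hy ?_)))
    have := hφ (show _ ∈ 𝔫 from hlt)
    simpa [mul_comm] using this

theorem specializeRight_mul_specializeRight_mem_range {k F B : Type*} [Field k] [IsAlgClosed k]
    [Field F] [Algebra k F] [CommRing B] [IsDomain B] [Algebra k B] [Algebra.FiniteType k B]
    {u u' : F ⊗[k] B} (huu' : u * u' = 1) (y y' : B →ₐ[k] k) :
    ∃ c : k, specializeRight F y u * specializeRight F y' u' = algebraMap k F c := by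
  set g := specializeRight F y u * specializeRight F y' u'
  have : Nontrivial (F ⊗[k] B) := by
    have := (specializeRight F y).toRingHom.domain_nontrivial
    exact this
  have hmem : ∀ V : ValuationSubring F, Set.range (algebraMap k F) ⊆ V.toSubring → g ∈ V := by
    intro V hV
    have hv : ∀ c : k, V.valuation (algebraMap k F c) ≤ 1 := fun c =>
      (V.valuation_le_one_iff _).2 (hV ⟨c, rfl⟩)
    obtain ⟨γ, β, hβ, h⟩ := exists_valuation_specializeRight_bound V.valuation hv
      (left_ne_zero_of_mul_eq_one huu')
    obtain ⟨γ', β', hβ', h'⟩ := exists_valuation_specializeRight_bound V.valuation hv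
      (right_ne_zero_of_mul_eq_one huu')
    obtain ⟨z, hz⟩ := exists_algHom_apply_ne_zero (k := k)
      (mt IsNilpotent.eq_zero (mul_ne_zero hβ hβ'))
    rw [map_mul] at hz
    have h1 : γ * γ' = 1 := by
      rw [← (h z).2 (left_ne_zero_of_mul hz), ← (h' z).2 (right_ne_zero_of_mul hz), ← map_mul,
        ← map_mul, huu', map_one, map_one]
    rw [← V.valuation_le_one_iff, map_mul, ← h1]
    exact mul_le_mul' (h y).1 (h' y').1
  have hgk : g ∈ (integralClosure k F).toSubring := by
    have : IsIntegrallyClosedIn (integralClosure k F).toSubring F :=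
      inferInstanceAs (IsIntegrallyClosedIn (integralClosure k F) F)
    by_contra hg
    obtain ⟨V, hV, hgV⟩ := Subring.exists_le_valuationSubring_of_isIntegrallyClosedIn hg
    refine hgV (hmem V ?_)
    rintro _ ⟨c, rfl⟩
    exact hV ((integralClosure k F).algebraMap_mem c)
  have := IsAlgClosed.algebraMap_bijective_of_isIntegral (k := k) (K := integralClosure k F)
  obtain ⟨c, hc⟩ := this.2 ⟨g, hgk⟩
  exact ⟨c, (congrArg Subtype.val hc).symm⟩

theorem specializeRight_mul_specializeRight_eq_algebraMap {k A B : Type*} [Field k]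
    [IsAlgClosed k] [CommRing A] [Algebra k A] [IsReduced A] [ConnectedSpace (PrimeSpectrum A)]
    [CommRing B] [Algebra k B] [Algebra.FiniteType k B] {u u' : A ⊗[k] B} (huu' : u * u' = 1)
    (q : Ideal B) [q.IsPrime] (y y' : B ⧸ q →ₐ[k] k) :
    ∃ c : k, specializeRight A (y.comp (Ideal.Quotient.mkₐ k q)) u *
      specializeRight A (y'.comp (Ideal.Quotient.mkₐ k q)) u' = algebraMap k A c := by
  obtain ⟨c, hc⟩ := exists_isNilpotent_sub_algebraMap (k := k)
    (specializeRight A (y.comp (Ideal.Quotient.mkₐ k q)) u *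
      specializeRight A (y'.comp (Ideal.Quotient.mkₐ k q)) u') (fun p hp => by
    let f : A →ₐ[k] p.ResidueField := IsScalarTower.toAlgHom k A p.ResidueField
    let θ := Algebra.TensorProduct.map f (Ideal.Quotient.mkₐ k q)
    obtain ⟨c, hc⟩ := specializeRight_mul_specializeRight_mem_range (u := θ u) (u' := θ u')
      (by rw [← map_mul, huu', map_one]) y y'
    refine ⟨c, ?_⟩
    rw [specializeRight_map, specializeRight_map, ← map_mul] at hc
    rw [← Ideal.algebraMap_residueField_eq_zero, map_sub, sub_eq_zero,
      ← IsScalarTower.algebraMap_apply]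
    exact hc)
  exact ⟨c, sub_eq_zero.1 hc.eq_zero⟩

/-- Specialization of the first tensor factor at a `k`-point. -/
def specializeLeft {k : Type*} [Field k] {A : Type*} (B : Type*) [CommRing A] [Algebra k A]
    [CommRing B] [Algebra k B] (x : A →ₐ[k] k) : A ⊗[k] B →ₐ[k] B :=
  (Algebra.TensorProduct.lid k B).toAlgHom.comp
    (Algebra.TensorProduct.map x (AlgHom.id k B))

@[simp]
theorem specializeLeft_tmul {k A B : Type*} [Field k] [CommRing A] [Algebra k A]
    [CommRing B] [Algebra k B] (x : A →ₐ[k] k) (a : A) (b : B) :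
    specializeLeft B x (a ⊗ₜ b) = x a • b := by
  simp [specializeLeft]

theorem apply_specializeLeft {k A B : Type*} [Field k] [CommRing A] [Algebra k A]
    [CommRing B] [Algebra k B] (x : A →ₐ[k] k) (y : B →ₐ[k] k) (w : A ⊗[k] B) :
    y (specializeLeft B x w) = x (specializeRight A y w) := by
  have : y.comp (specializeLeft B x) = x.comp (specializeRight A y) := by
    ext <;> simp
  exact DFunLike.congr_fun this w

theorem specializeLeft_eq_zero_of_mem_range {k A B : Type*} [Field k] [CommRing A] [Algebra k A]
    [CommRing B] [Algebra k B] (x : A →ₐ[k] k) (N : Submodule k B) {w : A ⊗[k] B}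
    (hw : w ∈ LinearMap.range (TensorProduct.map
      ((RingHom.ker x).restrictScalars k).subtype N.subtype)) :
    specializeLeft B x w = 0 := by
  obtain ⟨w, rfl⟩ := hw
  induction w with
  | zero => simp
  | add w w' h h' => rw [map_add, map_add, h, h', add_zero]
  | tmul a b =>
    have : x (a : A) = 0 := a.2
    simp [this]

theorem map_mk_eq_zero_of_mem_range {k A B : Type*} [Field k] [CommRing A] [Algebra k A]
    [CommRing B] [Algebra k B] (M : Submodule k A) (J : Ideal B) {w : A ⊗[k] B}
    (hw : w ∈ LinearMap.range (TensorProduct.map M.subtype (J.restrictScalars k).subtype)) :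
    Algebra.TensorProduct.map (AlgHom.id k A) (Ideal.Quotient.mkₐ k J) w = 0 := by
  obtain ⟨w, rfl⟩ := hw
  induction w with
  | zero => simp
  | add w w' h h' => rw [map_add, map_add, h, h', add_zero]
  | tmul a b =>
    have : Ideal.Quotient.mk J (b : B) = 0 := Ideal.Quotient.eq_zero_iff_mem.2 b.2
    simp [this]

theorem mem_range_map_nilradical {k A B : Type*} [Field k] [IsAlgClosed k] [CommRing A]
    [Algebra k A] [CommRing B] [Algebra k B] [Algebra.FiniteType k B]
    [ConnectedSpace (PrimeSpectrum B)] (x : A →ₐ[k] k) (y₀ : B →ₐ[k] k) {w : A ⊗[k] B}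
    (hx : specializeLeft B x w = 0) (hy₀ : specializeRight A y₀ w = 0)
    (h : ∀ (q : Ideal B) [q.IsPrime] (y y' : B ⧸ q →ₐ[k] k),
      specializeRight A (y.comp (Ideal.Quotient.mkₐ k q)) w =
        specializeRight A (y'.comp (Ideal.Quotient.mkₐ k q)) w) :
    w ∈ LinearMap.range (TensorProduct.map ((RingHom.ker x).restrictScalars k).subtype
      ((nilradical B).restrictScalars k).subtype) := by
  obtain ⟨b, rfl⟩ := TensorProduct.eq_repr_basis_left (Module.Basis.ofVectorSpace k A) w
  set 𝒜 := Module.Basis.ofVectorSpace k A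
  have hspec : ∀ (y : B →ₐ[k] k) i,
      𝒜.repr (specializeRight A y (b.sum fun i m => 𝒜 i ⊗ₜ m)) i = y (b i) := fun y i => by
    classical
    simp only [Finsupp.sum, map_sum, specializeRight_tmul, map_smul, Module.Basis.repr_self,
      Finsupp.finsetSum_apply, Finsupp.smul_apply, Finsupp.single_apply, smul_eq_mul, mul_ite,
      mul_one, mul_zero, Finset.sum_ite_eq', Finsupp.mem_support_iff]
    split_ifs with hi
    · rfl
    · rw [not_not.1 hi, map_zero]
  have hb : ∀ i, b i ∈ nilradical B := fun i => by
    obtain ⟨c, hc⟩ := exists_isNilpotent_sub_algebraMap (k := k) (b i) (fun q hq =>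
      exists_sub_algebraMap_mem_of_forall_algHom_eq q (b i) (fun y y' => by
        have := congrArg (fun a => 𝒜.repr a i) (h q y y')
        simp only [hspec] at this
        exact this))
    have h0 : y₀ (b i) = 0 := by rw [← hspec, hy₀, map_zero, Finsupp.zero_apply]
    have hc0 := (hc.map y₀).eq_zero
    rw [map_sub, h0, AlgHom.commutes, zero_sub, neg_eq_zero, Algebra.algebraMap_self_apply] at hc0
    simpa [hc0, mem_nilradical] using hc
  have hw : (b.sum fun i m => 𝒜 i ⊗ₜ[k] m) =
      b.sum fun i m => (𝒜 i - algebraMap k A (x (𝒜 i))) ⊗ₜ[k] m := by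
    rw [← sub_eq_zero, ← Finsupp.sum_sub]
    simp only [← TensorProduct.sub_tmul, sub_sub_cancel]
    have := congrArg (fun z => (1 : A) ⊗ₜ[k] z) hx
    simpa [Finsupp.sum, TensorProduct.tmul_sum, Algebra.algebraMap_eq_smul_one,
      TensorProduct.smul_tmul] using this
  rw [hw]
  refine Submodule.sum_mem _ fun i _ => ⟨(⟨_, ?_⟩ : (RingHom.ker x).restrictScalars k) ⊗ₜ
    (⟨b i, hb i⟩ : (nilradical B).restrictScalars k), by simp; rfl⟩
  simp [RingHom.mem_ker]

theorem exists_units_tmul_mul_one_add {k A B : Type*} [Field k] [IsAlgClosed k] [CommRing A]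
    [Algebra k A] [IsReduced A] [ConnectedSpace (PrimeSpectrum A)] [CommRing B] [Algebra k B]
    [Algebra.FiniteType k B] [ConnectedSpace (PrimeSpectrum B)] (x : A →ₐ[k] k)
    (u : (A ⊗[k] B)ˣ) :
    ∃ (a : Aˣ) (b : Bˣ), ∃ w ∈ LinearMap.range (TensorProduct.map
        ((RingHom.ker x).restrictScalars k).subtype
        ((nilradical B).restrictScalars k).subtype),
      (u : A ⊗[k] B) = ((a : A) ⊗ₜ (b : B)) * (1 + w) := by
  have : Nontrivial B := PrimeSpectrum.nonempty_iff_nontrivial.1 inferInstance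
  obtain ⟨y₀, -⟩ := exists_algHom_apply_ne_zero (k := k) (b := (1 : B)) not_isNilpotent_one
  let a : Aˣ := Units.map (specializeRight A y₀).toMonoidHom u
  let c : kˣ := Units.map x.toMonoidHom a
  let b : Bˣ := Units.map (specializeLeft B x).toMonoidHom u *
    Units.map (algebraMap k B).toMonoidHom c⁻¹
  let s : (A ⊗[k] B)ˣ :=
    Units.map (Algebra.TensorProduct.includeLeft (R := k) (S := k) (A := A) (B := B)).toMonoidHom a *
    Units.map (Algebra.TensorProduct.includeRight (R := k) (A := A) (B := B)).toMonoidHom b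
  have hs : (s : A ⊗[k] B) = (a : A) ⊗ₜ (b : B) := by simp [s]
  let t := s⁻¹ * u
  have hxt : specializeLeft B x (t : A ⊗[k] B) = 1 := by
    have : Units.map (specializeLeft B x).toMonoidHom t = 1 := by
      rw [map_mul, map_inv, inv_mul_eq_one]
      ext
      have hc : algebraMap k B c * algebraMap k B (c⁻¹ : kˣ) = 1 := by
        rw [← map_mul, c.mul_inv, map_one]
      have hxa : x a = c := rfl
      have hb : (b : B) = specializeLeft B x u * algebraMap k B (c⁻¹ : kˣ) := rfl
      change specializeLeft B x s = specializeLeft B x u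
      rw [hs, specializeLeft_tmul, hxa, Algebra.smul_def, hb, mul_left_comm, hc, mul_one]
    exact congrArg Units.val this
  have hyt : specializeRight A y₀ (t : A ⊗[k] B) = 1 := by
    have : Units.map (specializeRight A y₀).toMonoidHom t = 1 := by
      rw [map_mul, map_inv, inv_mul_eq_one]
      ext
      have hb : y₀ b = 1 := by
        change y₀ (specializeLeft B x u * algebraMap k B (c⁻¹ : kˣ)) = 1
        rw [map_mul, apply_specializeLeft, AlgHom.commutes]
        exact c.mul_inv
      change specializeRight A y₀ s = specializeRight A y₀ u
      rw [hs, specializeRight_tmul, hb, one_smul]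
      rfl
    exact congrArg Units.val this
  have hA : ∀ y : B →ₐ[k] k, x (specializeRight A y t) = 1 := fun y => by
    rw [← apply_specializeLeft, hxt, map_one]
  refine ⟨a, b, t - 1, mem_range_map_nilradical x y₀ (by rw [map_sub, hxt, map_one, sub_self])
    (by rw [map_sub, hyt, map_one, sub_self]) (fun q _ y y' => ?_), ?_⟩
  · obtain ⟨d, hd⟩ := specializeRight_mul_specializeRight_eq_algebraMap t.mul_inv q y y'
    set z := y.comp (Ideal.Quotient.mkₐ k q)
    set z' := y'.comp (Ideal.Quotient.mkₐ k q)
    have hinv : specializeRight A z' t * specializeRight A z' (t⁻¹ : (A ⊗[k] B)ˣ) = 1 := by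
      rw [← map_mul, t.mul_inv, map_one]
    have hd1 : d = 1 := by
      have h1 := congrArg x hd
      have h2 := congrArg x hinv
      rw [map_mul, hA, one_mul] at h1 h2
      rw [AlgHom.commutes, h2, map_one] at h1
      exact h1.symm
    rw [hd1, map_one] at hd
    have : specializeRight A z t = specializeRight A z' t := by
      calc _ = specializeRight A z t * (specializeRight A z' t *
            specializeRight A z' (t⁻¹ : (A ⊗[k] B)ˣ)) := by rw [hinv, mul_one]
        _ = specializeRight A z t * specializeRight A z' (t⁻¹ : (A ⊗[k] B)ˣ) *
            specializeRight A z' t := by ring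
        _ = _ := by rw [hd, one_mul]
    rw [map_sub, map_sub, this, map_one, map_one]
  · rw [add_sub_cancel, ← hs, ← Units.val_mul, mul_inv_cancel_left]

theorem connectedSpace_primeSpectrum_of_injective {R S : Type*} [CommRing R] [CommRing S]
    [ConnectedSpace (PrimeSpectrum S)] (f : R →+* S) (hf : Function.Injective f) :
    ConnectedSpace (PrimeSpectrum R) := by
  have hd : DenseRange (PrimeSpectrum.comap f) := by
    rw [PrimeSpectrum.denseRange_comap_iff_ker_le_nilRadical,
      (RingHom.injective_iff_ker_eq_bot f).1 hf]
    exact bot_le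
  have hc : Continuous (PrimeSpectrum.comap f) := by fun_prop
  have := (isConnected_range hc).closure
  rw [hd.closure_range] at this
  exact connectedSpace_iff_univ.2 this

theorem exists_subalgebra_fg_unit_map_eq {k A B : Type*} [Field k] [CommRing A] [Algebra k A]
    [CommRing B] [Algebra k B] (u : (A ⊗[k] B)ˣ) :
    ∃ (B₀ : Subalgebra k B) (_ : B₀.FG) (u₀ : (A ⊗[k] B₀)ˣ),
      Algebra.TensorProduct.map (AlgHom.id k A) B₀.val u₀ = u := by
  obtain ⟨S, hS⟩ := TensorProduct.exists_finset (u : A ⊗[k] B)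
  obtain ⟨S', hS'⟩ := TensorProduct.exists_finset ((u⁻¹ : (A ⊗[k] B)ˣ) : A ⊗[k] B)
  classical
  let T : Finset B := (S ∪ S').image Prod.snd
  let B₀ := Algebra.adjoin k (T : Set B)
  let θ := Algebra.TensorProduct.map (AlgHom.id k A) B₀.val
  have hθ : Function.Injective θ :=
    Module.Flat.lTensor_preserves_injective_linearMap (M := A) B₀.val.toLinearMap
      Subtype.val_injective
  have hmem : ∀ R ⊆ S ∪ S', ∑ i ∈ R, i.1 ⊗ₜ[k] i.2 ∈ θ.range := fun R hR =>
    sum_mem fun i hi => by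
      have hi' : i.2 ∈ T := Finset.mem_image_of_mem _ (hR hi)
      exact ⟨i.1 ⊗ₜ ⟨i.2, Algebra.subset_adjoin hi'⟩, by simp [θ]⟩
  obtain ⟨v, hv⟩ := hmem S Finset.subset_union_left
  obtain ⟨v', hv'⟩ := hmem S' Finset.subset_union_right
  have hvv' : v * v' = 1 := hθ <| by
    rw [map_mul, map_one]
    exact (congrArg₂ (· * ·) (hv.trans hS.symm) (hv'.trans hS'.symm)).trans u.mul_inv
  exact ⟨B₀, ⟨T, rfl⟩, Units.mkOfMulEqOne v v' hvv', hv.trans hS.symm⟩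

theorem exists_units_tmul_mul_one_add_of_connectedSpace {k A B : Type*} [Field k] [IsAlgClosed k]
    [CommRing A] [Algebra k A] [IsReduced A] [ConnectedSpace (PrimeSpectrum A)] [CommRing B]
    [Algebra k B] [ConnectedSpace (PrimeSpectrum B)] (x : A →ₐ[k] k) (u : (A ⊗[k] B)ˣ) :
    ∃ (a : Aˣ) (b : Bˣ), ∃ w ∈ LinearMap.range (TensorProduct.map
        ((RingHom.ker x).restrictScalars k).subtype
        ((nilradical B).restrictScalars k).subtype),
      (u : A ⊗[k] B) = ((a : A) ⊗ₜ (b : B)) * (1 + w) := by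
  obtain ⟨B₀, hB₀, u₀, hu₀⟩ := exists_subalgebra_fg_unit_map_eq u
  have : Algebra.FiniteType k B₀ := B₀.fg_iff_finiteType.1 hB₀
  have := connectedSpace_primeSpectrum_of_injective B₀.val.toRingHom Subtype.val_injective
  obtain ⟨a, b, w₀, hw₀, h⟩ := exists_units_tmul_mul_one_add x u₀
  refine ⟨a, Units.map B₀.val.toMonoidHom b,
    Algebra.TensorProduct.map (AlgHom.id k A) B₀.val w₀, ?_, ?_⟩
  · clear h
    obtain ⟨w, rfl⟩ := hw₀
    induction w with
    | zero => simp
    | add w w' h h' => rw [map_add, map_add]; exact add_mem h h'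
    | tmul a b =>
      exact ⟨a ⊗ₜ ⟨(b : B₀), (mem_nilradical.1 b.2).map B₀.val⟩, by simp⟩
  · rw [← hu₀, h, map_mul, map_add, map_one]
    rfl

theorem tmul_eq_tmul_of_mul_one_add_eq {k A B : Type*} [Field k] [CommRing A] [Algebra k A]
    [CommRing B] [Algebra k B] [Nontrivial B] (x : A →ₐ[k] k) (a a' : Aˣ) (b b' : Bˣ)
    {w w' : A ⊗[k] B}
    (hw : w ∈ LinearMap.range (TensorProduct.map ((RingHom.ker x).restrictScalars k).subtype
      ((nilradical B).restrictScalars k).subtype))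
    (hw' : w' ∈ LinearMap.range (TensorProduct.map ((RingHom.ker x).restrictScalars k).subtype
      ((nilradical B).restrictScalars k).subtype))
    (h : ((a : A) ⊗ₜ (b : B)) * (1 + w) = ((a' : A) ⊗ₜ (b' : B)) * (1 + w')) :
    (a : A) ⊗ₜ[k] (b : B) = (a' : A) ⊗ₜ (b' : B) := by
  have hx : x a • (b : B) = x a' • (b' : B) := by
    simpa [specializeLeft_eq_zero_of_mem_range x _ hw, specializeLeft_eq_zero_of_mem_range x _ hw']
      using congrArg (specializeLeft B x) h
  have hq : (a : A) ⊗ₜ[k] Ideal.Quotient.mk (nilradical B) b =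
      (a' : A) ⊗ₜ[k] Ideal.Quotient.mk (nilradical B) b' := by
    simpa [map_mk_eq_zero_of_mem_range _ _ hw, map_mk_eq_zero_of_mem_range _ _ hw']
      using congrArg (Algebra.TensorProduct.map (AlgHom.id k A)
        (Ideal.Quotient.mkₐ k (nilradical B))) h
  have hxa : x a' ≠ 0 := (a'.isUnit.map x).ne_zero
  have hb : (b' : B) = ((x a')⁻¹ * x a) • (b : B) := by
    rw [mul_smul, hx, smul_smul, inv_mul_cancel₀ hxa, one_smul]
  set l := (x a')⁻¹ * x a
  have hl : Ideal.Quotient.mk (nilradical B) (l • (b : B)) =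
      l • Ideal.Quotient.mk (nilradical B) (b : B) := rfl
  rw [hb, hl, ← TensorProduct.smul_tmul] at hq
  rw [hb, ← TensorProduct.smul_tmul]
  have : Nontrivial (B ⧸ nilradical B) := Ideal.Quotient.nontrivial_iff.2 (by
    rw [Ne, Ideal.eq_top_iff_one, mem_nilradical]
    exact not_isNilpotent_one)
  have hbu : IsUnit (Ideal.Quotient.mk (nilradical B) (b : B)) := b.isUnit.map _
  obtain ⟨e, he⟩ := hbu.exists_right_inv
  have h1 := congrArg (· * ((1 : A) ⊗ₜ[k] e)) hq
  simp only [Algebra.TensorProduct.tmul_mul_tmul, mul_one, he] at h1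
  rw [Algebra.TensorProduct.includeLeft_injective (S := k)
    (algebraMap k (B ⧸ nilradical B)).injective h1]

/-- with `A` reduced with connected spectrum, `𝔪 ⊂ A` maximal with
`A/𝔪 = k`, and `B` any `k`-algebra with connected spectrum, `(A ⊗_k B)^×` is the
internal direct sum of `A^×B^×` and `1 + 𝔪 ⊗ Nil(B)`. -/
theorem units_directSum_of_connected {k : Type u} [Field k] [IsAlgClosed k]
    (A B : Type u) [CommRing A] [Algebra k A] [CommRing B] [Algebra k B]
    [IsReduced A] [ConnectedSpace (PrimeSpectrum A)] [ConnectedSpace (PrimeSpectrum B)]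
    (𝔪 : Ideal A) [𝔪.IsMaximal]
    (hres : ∀ a : A, ∃ c : k, a - algebraMap k A c ∈ 𝔪) :
    IsUnitsDirectSum k A B 𝔪 := by
  have hk : Function.Bijective (algebraMap k (A ⧸ 𝔪)) := by
    refine ⟨RingHom.injective _, fun z => ?_⟩
    obtain ⟨a, rfl⟩ := Ideal.Quotient.mk_surjective z
    obtain ⟨c, hc⟩ := hres a
    exact ⟨c, (Ideal.Quotient.eq.2 hc).symm⟩
  obtain ⟨x, rfl⟩ : ∃ x : A →ₐ[k] k, RingHom.ker x = 𝔪 := by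
    refine ⟨(AlgEquiv.ofBijective (Algebra.ofId k (A ⧸ 𝔪)) hk).symm.toAlgHom.comp
      (Ideal.Quotient.mkₐ k 𝔪), ?_⟩
    ext a
    simp [RingHom.mem_ker, Ideal.Quotient.eq_zero_iff_mem]
  constructor
  · intro u
    obtain ⟨a, b, w, hw, hu⟩ := exists_units_tmul_mul_one_add_of_connectedSpace x u
    exact ⟨_, ⟨a, b, rfl⟩, _, ⟨w, hw, rfl⟩, hu⟩
  · rintro _ ⟨a, b, rfl⟩ _ ⟨a', b', rfl⟩ _ ⟨w, hw, rfl⟩ _ ⟨w', hw', rfl⟩ h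
    have : Nontrivial B := PrimeSpectrum.nonempty_iff_nontrivial.1 inferInstance
    have hs := tmul_eq_tmul_of_mul_one_add_eq x a a' b b' hw hw' h
    refine ⟨hs, ?_⟩
    have hunit : IsUnit ((a' : A) ⊗ₜ[k] (b' : B)) := by
      rw [← mul_one (a' : A), ← one_mul (b' : B), ← Algebra.TensorProduct.tmul_mul_tmul]
      exact (a'.isUnit.map (Algebra.TensorProduct.includeLeft (R := k) (S := k) (B := B))).mul
        (b'.isUnit.map (Algebra.TensorProduct.includeRight (R := k) (A := A)))
    rw [hs] at h
    exact hunit.mul_left_cancel h
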